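/- arXiv:2008.05127 — 2 statements merged into one kernel-verified Lean document; each statement's English description precedes it below -/
import Mathlib

section
/- Let α be a real number with −2 ≤ α < N − 4. Then for every u ∈ C_c^∞(ℍ^N∖{o}) one has ∫_{ℍ^N} r^{−α} (Δ_r u + ((N+α)(N−α−4)/4) · u/r²)² dv ≤ ∫_{ℍ^N} (Δ_r u)²/r^α dv − ((N+α)(N−α−4)/2) ∫_{ℍ^N} |∇_r u|²/r^{α+2} dv + ((N+α)(N−3α−8)(N−α−4)²/16) ∫_{ℍ^N} u²/r^{α+4} dv. -/
open MeasureTheory Real Set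

noncomputable section

/-- The radial derivative `∇_r u = ∂u/∂r` of a function `u(r,σ)`. -/
def radGrad (N : ℕ) (u : ℝ → EuclideanSpace ℝ (Fin N) → ℝ) :
    ℝ → EuclideanSpace ℝ (Fin N) → ℝ :=
  fun r σ => deriv (fun s => u s σ) r

/-- The radial Laplacian `Δ_r u = ∂²u/∂r² + (N-1) coth r · ∂u/∂r`. -/
def radLap (N : ℕ) (u : ℝ → EuclideanSpace ℝ (Fin N) → ℝ) :
    ℝ → EuclideanSpace ℝ (Fin N) → ℝ :=
  fun r σ => deriv (fun s => deriv (fun t => u t σ) s) r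
    + ((N : ℝ) - 1) * (Real.cosh r / Real.sinh r) * deriv (fun s => u s σ) r

/-- The higher order radial derivative `∇_r^k u`: `Δ_r^{k/2} u` for even `k`,
`∂_r (Δ_r^{(k-1)/2} u)` for odd `k`. -/
def radPow (N k : ℕ) (u : ℝ → EuclideanSpace ℝ (Fin N) → ℝ) :
    ℝ → EuclideanSpace ℝ (Fin N) → ℝ :=
  if Even k then (radLap N)^[k / 2] u else radGrad N ((radLap N)^[k / 2] u)

/-- The integral over the hyperbolic space `ℍ^N` in polar coordinates:
`∫_{S^{N-1}} ∫_0^∞ F(r,σ) (sinh r)^{N-1} dr dσ`, where `dσ` is the standard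
surface measure (the `(N-1)`-dimensional Hausdorff measure) on the unit sphere. -/
def hypInt (N : ℕ) (F : ℝ → EuclideanSpace ℝ (Fin N) → ℝ) : ℝ :=
  ∫ σ in Metric.sphere (0 : EuclideanSpace ℝ (Fin N)) 1,
    (∫ r in Ioi (0 : ℝ), F r σ * Real.sinh r ^ (N - 1)) ∂μH[(N : ℝ) - 1]

/-- `u ∈ C_c^∞(ℍ^N)`: `u(r,σ)` smooth (including at the pole `r = 0`) and
vanishing for all `r` larger than some `R`. -/
def IsCc (N : ℕ) (u : ℝ → EuclideanSpace ℝ (Fin N) → ℝ) : Prop :=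
  ContDiff ℝ (⊤ : ℕ∞) (Function.uncurry u) ∧
  ∃ R : ℝ, ∀ r : ℝ, R < r → ∀ σ ∈ Metric.sphere (0 : EuclideanSpace ℝ (Fin N)) 1, u r σ = 0

/-- `u ∈ C_c^∞(ℍ^N \ {o})`: `u(r,σ)` smooth with support contained in
`[a,b] × S^{N-1}` for some `0 < a ≤ b`. -/
def IsCcAway (N : ℕ) (u : ℝ → EuclideanSpace ℝ (Fin N) → ℝ) : Prop :=
  ContDiff ℝ (⊤ : ℕ∞) (Function.uncurry u) ∧
  ∃ a b : ℝ, 0 < a ∧ a ≤ b ∧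
    ∀ r : ℝ, r ∉ Icc a b → ∀ σ ∈ Metric.sphere (0 : EuclideanSpace ℝ (Fin N)) 1, u r σ = 0

open Metric Module in
/-- A closed hemisphere is a Lipschitz image of a ball of the equatorial hyperplane, so it has finite
Hausdorff measure of codimension one. -/
theorem hausdorffMeasure_hemisphere_lt_top {E : Type*} [NormedAddCommGroup E]
    [InnerProductSpace ℝ E] [FiniteDimensional ℝ E] [MeasurableSpace E] [BorelSpace E]
    {v : E} (hv : ‖v‖ = 1) :
    μH[(finrank ℝ E : ℝ) - 1] {x ∈ sphere (0 : E) 1 | inner ℝ v x ≤ 0} < ⊤ := by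
  have hv0 : v ≠ 0 := by
    rintro rfl
    simp at hv
  set f : (ℝ ∙ v)ᗮ → E := fun w => stereoInvFunAux v (w : E)
  have hfC : ContDiff ℝ 1 f := contDiff_stereoInvFunAux.comp (ℝ ∙ v)ᗮ.subtypeL.contDiff
  obtain ⟨K, hK⟩ := hfC.contDiffOn.exists_lipschitzOnWith one_ne_zero
    (convex_closedBall (0 : (ℝ ∙ v)ᗮ) 2) (isCompact_closedBall 0 2)
  have hdim : finrank ℝ (ℝ ∙ v)ᗮ + 1 = finrank ℝ E := by
    rw [← (ℝ ∙ v).finrank_add_finrank_orthogonal, finrank_span_singleton hv0, add_comm]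
  have hd : (finrank ℝ E : ℝ) - 1 = finrank ℝ (ℝ ∙ v)ᗮ := by
    rw [← hdim]
    push_cast
    ring
  rw [hd]
  have hsub : {x ∈ sphere (0 : E) 1 | inner ℝ v x ≤ 0} ⊆ f '' closedBall 0 2 := by
    rintro x ⟨hx, hvx⟩
    have hxv : x ≠ v := by
      rintro rfl
      rw [real_inner_self_eq_norm_sq, hv] at hvx
      norm_num at hvx
    refine ⟨stereoToFun v x, ?_, congrArg Subtype.val (stereo_left_inv hv (x := ⟨x, hx⟩) hxv)⟩
    rw [mem_closedBall_zero_iff, stereoToFun_apply, norm_smul, Real.norm_eq_abs,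
      innerSL_apply_apply, abs_of_pos (by apply div_pos <;> linarith)]
    have h1 : 2 / (1 - inner ℝ v x) ≤ 2 := by
      rw [div_le_iff₀ (by linarith)]
      linarith
    have h2 : ‖(ℝ ∙ v)ᗮ.orthogonalProjectionOnto x‖ ≤ 1 :=
      ((ℝ ∙ v)ᗮ.norm_orthogonalProjectionOnto_apply_le x).trans (mem_sphere_zero_iff_norm.1 hx).le
    nlinarith [norm_nonneg ((ℝ ∙ v)ᗮ.orthogonalProjectionOnto x)]
  refine (measure_mono hsub).trans_lt
    ((hK.hausdorffMeasure_image_le (Nat.cast_nonneg _)).trans_lt (ENNReal.mul_lt_top ?_ ?_))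
  · exact ENNReal.rpow_lt_top_of_nonneg (Nat.cast_nonneg _) ENNReal.coe_ne_top
  · exact (isCompact_closedBall _ _).measure_lt_top

open Metric Module in
theorem hausdorffMeasure_sphere_lt_top {E : Type*} [NormedAddCommGroup E]
    [InnerProductSpace ℝ E] [FiniteDimensional ℝ E] [MeasurableSpace E] [BorelSpace E]
    [Nontrivial E] : μH[(finrank ℝ E : ℝ) - 1] (sphere (0 : E) 1) < ⊤ := by
  obtain ⟨v, hv⟩ := exists_norm_eq E zero_le_one
  have hsub : sphere (0 : E) 1 ⊆ {x ∈ sphere (0 : E) 1 | inner ℝ v x ≤ 0} ∪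
      {x ∈ sphere (0 : E) 1 | inner ℝ (-v) x ≤ 0} := by
    intro x hx
    rcases le_total (inner ℝ v x) 0 with h | h
    · exact Or.inl ⟨hx, h⟩
    · exact Or.inr ⟨hx, by rw [inner_neg_left]; linarith⟩
  exact (measure_mono hsub).trans_lt (measure_union_lt_top
    (hausdorffMeasure_hemisphere_lt_top hv)
    (hausdorffMeasure_hemisphere_lt_top (by rwa [norm_neg])))

/-- The sphere carries a finite surface measure. -/
theorem isFiniteMeasure_surface {N : ℕ} (hN : 0 < N) : IsFiniteMeasure
    ((μH[(N : ℝ) - 1] : Measure (EuclideanSpace ℝ (Fin N))).restrict (Metric.sphere 0 1)) := by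
  have : Nonempty (Fin N) := ⟨⟨0, hN⟩⟩
  have h := hausdorffMeasure_sphere_lt_top (E := EuclideanSpace ℝ (Fin N))
  rw [finrank_euclideanSpace_fin] at h
  exact ⟨by rwa [Measure.restrict_apply_univ]⟩

theorem sinh_le_mul_cosh {r : ℝ} (hr : 0 ≤ r) : sinh r ≤ r * cosh r := by
  have hd : ∀ x : ℝ, HasDerivAt (fun x => x * cosh x - sinh x) (x * sinh x) x := fun x => by
    refine (((hasDerivAt_id x).mul (hasDerivAt_cosh x)).sub (hasDerivAt_sinh x)).congr_deriv ?_
    simp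
  have hm : MonotoneOn (fun x => x * cosh x - sinh x) (Ici 0) := by
    refine monotoneOn_of_hasDerivWithinAt_nonneg (convex_Ici 0)
      (fun x _ => (hd x).continuousAt.continuousWithinAt)
      (fun x _ => (hd x).hasDerivWithinAt) fun x hx => ?_
    rw [interior_Ici] at hx
    exact mul_nonneg (le_of_lt hx) (sinh_nonneg_iff.2 (le_of_lt hx))
  have := hm self_mem_Ici hr hr
  simp only [zero_mul, sinh_zero, sub_zero] at this
  linarith

/-- A smooth function has a smooth radial derivative. -/
theorem contDiff_radGrad {N : ℕ} {u : ℝ → EuclideanSpace ℝ (Fin N) → ℝ}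
    (hu : ContDiff ℝ (⊤ : ℕ∞) (Function.uncurry u)) :
    ContDiff ℝ (⊤ : ℕ∞) (Function.uncurry (radGrad N u)) := by
  have h : ContDiff ℝ (⊤ : ℕ∞) fun p : ℝ × EuclideanSpace ℝ (Fin N) =>
      fderiv ℝ (fun s => u s p.2) p.1 1 := by
    refine ContDiff.fderiv_apply (n := (⊤ : ℕ∞)) (m := (⊤ : ℕ∞))
      (f := fun (p : ℝ × EuclideanSpace ℝ (Fin N)) s => u s p.2)
      ?_ contDiff_fst contDiff_const le_rfl
    exact hu.comp (contDiff_snd.prodMk (contDiff_snd.comp contDiff_fst))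
  exact h

theorem hasDerivAt_radGrad {N : ℕ} {u : ℝ → EuclideanSpace ℝ (Fin N) → ℝ}
    (hu : ContDiff ℝ (⊤ : ℕ∞) (Function.uncurry u)) (r : ℝ) (σ : EuclideanSpace ℝ (Fin N)) :
    HasDerivAt (fun s => u s σ) (radGrad N u r σ) r := by
  have h : ContDiff ℝ (⊤ : ℕ∞) fun s => u s σ := hu.comp (contDiff_id.prodMk contDiff_const)
  exact (h.differentiable (by simp) r).hasDerivAt

/-- The radial derivative of a function supported in the shell `[a,b]` is supported there. -/
theorem radGrad_eq_zero {N : ℕ} {u : ℝ → EuclideanSpace ℝ (Fin N) → ℝ} {a b : ℝ}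
    {σ : EuclideanSpace ℝ (Fin N)} (h : ∀ r ∉ Icc a b, u r σ = 0) :
    ∀ r ∉ Icc a b, radGrad N u r σ = 0 := by
  intro r hr
  have : (fun s => u s σ) =ᶠ[nhds r] fun _ => 0 := by
    filter_upwards [isClosed_Icc.isOpen_compl.mem_nhds hr] with s hs using h s hs
  simp [radGrad, this.deriv_eq]

/-- A function on `ℍ^N`, continuous away from the pole and supported in the shell `[a,b]`. -/
structure IsShell (N : ℕ) (a b : ℝ) (F : ℝ → EuclideanSpace ℝ (Fin N) → ℝ) : Prop where
  cont : ContinuousOn (Function.uncurry F) (Ioi 0 ×ˢ univ)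
  zero : ∀ σ ∈ Metric.sphere (0 : EuclideanSpace ℝ (Fin N)) 1, ∀ r ∉ Icc a b, F r σ = 0

theorem integrable_sub_const_mul_add_const_mul {X : Type*} [MeasurableSpace X] {μ : Measure X}
    {f g h : X → ℝ} (hf : Integrable f μ) (hg : Integrable g μ) (hh : Integrable h μ) (p q : ℝ) :
    Integrable (fun x => f x - p * g x + q * h x) μ :=
  (hf.sub (hg.const_mul p)).add (hh.const_mul q)

theorem integral_sub_const_mul_add_const_mul {X : Type*} [MeasurableSpace X] {μ : Measure X}
    {f g h : X → ℝ} (hf : Integrable f μ) (hg : Integrable g μ) (hh : Integrable h μ) (p q : ℝ) :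
    ∫ x, f x - p * g x + q * h x ∂μ = ∫ x, f x ∂μ - p * ∫ x, g x ∂μ + q * ∫ x, h x ∂μ := by
  rw [integral_add (f := fun x => f x - p * g x) (hf.sub (hg.const_mul p)) (hh.const_mul q),
    integral_sub hf (hg.const_mul p), integral_const_mul, integral_const_mul]

namespace IsShell

variable {N : ℕ} {a b : ℝ} {F : ℝ → EuclideanSpace ℝ (Fin N) → ℝ}
  {σ : EuclideanSpace ℝ (Fin N)}

theorem continuousOn_mul_sinh (hF : IsShell N a b F) (ha : 0 < a)
    (σ : EuclideanSpace ℝ (Fin N)) :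
    ContinuousOn (fun r => F r σ * sinh r ^ (N - 1)) (Icc a b) := by
  refine ContinuousOn.mul ?_ (by fun_prop)
  exact hF.cont.comp (f := fun r => (r, σ)) (by fun_prop)
    fun r hr => ⟨ha.trans_le hr.1, mem_univ _⟩

theorem integrableOn (hF : IsShell N a b F) (ha : 0 < a)
    (hσ : σ ∈ Metric.sphere (0 : EuclideanSpace ℝ (Fin N)) 1) :
    IntegrableOn (fun r => F r σ * sinh r ^ (N - 1)) (Ioi 0) :=
  ((hF.continuousOn_mul_sinh ha σ).integrableOn_Icc).of_forall_sdiff_eq_zero measurableSet_Ioi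
    fun r hr => by rw [hF.zero σ hσ r hr.2, zero_mul]

theorem integral_eq (hF : IsShell N a b F) (ha : 0 < a) (hab : a ≤ b)
    (hσ : σ ∈ Metric.sphere (0 : EuclideanSpace ℝ (Fin N)) 1) :
    ∫ r in Ioi 0, F r σ * sinh r ^ (N - 1) = ∫ r in a..b, F r σ * sinh r ^ (N - 1) := by
  rw [intervalIntegral.integral_of_le hab, ← integral_Icc_eq_integral_Ioc]
  exact setIntegral_eq_of_subset_of_forall_sdiff_eq_zero measurableSet_Ioi
    (fun r hr => ha.trans_le hr.1) fun r hr => by rw [hF.zero σ hσ r hr.2, zero_mul]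

/-- The radial integrals are integrable over the sphere. -/
theorem integrableOn_sphere (hF : IsShell N a b F) (ha : 0 < a) (hab : a ≤ b) (hN : 0 < N) :
    IntegrableOn (fun σ => ∫ r in Ioi 0, F r σ * sinh r ^ (N - 1))
      (Metric.sphere (0 : EuclideanSpace ℝ (Fin N)) 1) μH[(N : ℝ) - 1] := by
  have := isFiniteMeasure_surface hN
  have hc : Continuous fun σ => ∫ r in a..b, F (max r a) σ * sinh r ^ (N - 1) := by
    refine intervalIntegral.continuous_parametric_intervalIntegral_of_continuous' ?_ a b
    refine Continuous.mul ?_ (by fun_prop)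
    refine hF.cont.comp_continuous
      (f := fun p : EuclideanSpace ℝ (Fin N) × ℝ => (max p.2 a, p.1)) (by fun_prop)
      fun p => ⟨lt_max_of_lt_right ha, mem_univ _⟩
  have hi : IntegrableOn (fun σ => ∫ r in a..b, F (max r a) σ * sinh r ^ (N - 1))
      (Metric.sphere (0 : EuclideanSpace ℝ (Fin N)) 1) μH[(N : ℝ) - 1] := by
    obtain ⟨C, hC⟩ := (isCompact_sphere (0 : EuclideanSpace ℝ (Fin N)) 1).exists_bound_of_continuousOn
      hc.continuousOn
    exact Integrable.of_bound hc.aestronglyMeasurable C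
      ((ae_restrict_iff' Metric.isClosed_sphere.measurableSet).2 (ae_of_all _ hC))
  refine hi.congr_fun (fun σ hσ => ?_) Metric.isClosed_sphere.measurableSet
  simp only
  rw [hF.integral_eq ha hab hσ]
  refine intervalIntegral.integral_congr fun r hr => ?_
  rw [uIcc_of_le hab] at hr
  simp only [max_eq_left hr.1]

end IsShell

/-- The radial energy identity: the derivative of
`sinh^{m+1} (f f' r^{-α-2} + (α+2)/2 f² r^{-α-3})`. -/
theorem hasDerivAt_flux {f f₁ : ℝ → ℝ} {f₂ : ℝ} {r α : ℝ} (m : ℕ) (hr : 0 < r)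
    (h₁ : HasDerivAt f (f₁ r) r) (h₂ : HasDerivAt f₁ f₂ r) :
    HasDerivAt (fun r => sinh r ^ (m + 1) * (f r * f₁ r * r ^ (-α - 2)
        + (α + 2) / 2 * (f r ^ 2 * r ^ (-α - 3))))
      (((f₂ + (m + 1) * (cosh r / sinh r) * f₁ r) * f r * r ^ (-α - 2) + f₁ r ^ 2 * r ^ (-α - 2)
        + (α + 2) / 2 * f r ^ 2 * ((m + 1) * (cosh r / sinh r) * r ^ (-α - 3)
          - (α + 3) * r ^ (-α - 4))) * sinh r ^ (m + 1)) r := by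
  have hs : sinh r ≠ 0 := (sinh_pos_iff.2 hr).ne'
  have hP := hasDerivAt_rpow_const (x := r) (p := -α - 2) (Or.inl hr.ne')
  have hQ := hasDerivAt_rpow_const (x := r) (p := -α - 3) (Or.inl hr.ne')
  have hw := (hasDerivAt_sinh r).pow (m + 1)
  refine (hw.mul (((h₁.mul h₂).mul hP).add
    (((h₁.pow 2).mul hQ).const_mul ((α + 2) / 2)))).congr_deriv ?_
  rw [show -α - 2 - 1 = -α - 3 by ring, show -α - 3 - 1 = -α - 4 by ring]
  simp only [Pi.add_apply, Pi.mul_apply, Pi.pow_apply, Nat.cast_add, Nat.cast_one,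
    Nat.add_sub_cancel, Nat.cast_ofNat]
  field_simp
  ring

/-- The pointwise inequality behind the weighted Rellich estimate, with `x = f`, `y = f'`,
`z = Δ_r f`. -/
theorem rellich_pointwise {r α n c x y z : ℝ} (hr : 0 < r) (hα : -2 ≤ α) (hn : 1 ≤ n)
    (hc0 : 0 ≤ c) (hc : c = (n + α) * (n - α - 4) / 4) :
    r ^ (-α) * (z + c * x / r ^ 2) ^ 2 ≤ z ^ 2 / r ^ α - 2 * c * (y ^ 2 / r ^ (α + 2))
      + c * ((n - 3 * α - 8) * (n - α - 4) / 4) * (x ^ 2 / r ^ (α + 4))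
      + 2 * c * (z * x * r ^ (-α - 2) + y ^ 2 * r ^ (-α - 2)
        + (α + 2) / 2 * x ^ 2 * ((n - 1) * (cosh r / sinh r) * r ^ (-α - 3)
          - (α + 3) * r ^ (-α - 4))) := by
  have hs : 0 < sinh r := sinh_pos_iff.2 hr
  have hk : 0 ≤ r * cosh r / sinh r - 1 := by
    rw [sub_nonneg, one_le_div hs]
    exact sinh_le_mul_cosh hr.le
  have hp : 0 < r ^ α := rpow_pos_of_pos hr α
  have e₀ : r ^ (-α) = (r ^ α)⁻¹ := rpow_neg hr.le α
  have e₂ : r ^ (-α - 2) = (r ^ α)⁻¹ / r ^ 2 := by rw [rpow_sub hr, e₀]; norm_cast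
  have e₃ : r ^ (-α - 3) = (r ^ α)⁻¹ / r ^ 3 := by rw [rpow_sub hr, e₀]; norm_cast
  have e₄ : r ^ (-α - 4) = (r ^ α)⁻¹ / r ^ 4 := by rw [rpow_sub hr, e₀]; norm_cast
  have d₂ : r ^ (α + 2) = r ^ α * r ^ 2 := by rw [rpow_add hr]; norm_cast
  have d₄ : r ^ (α + 4) = r ^ α * r ^ 4 := by rw [rpow_add hr]; norm_cast
  rw [e₀, e₂, e₃, e₄, d₂, d₄, ← sub_nonneg]
  have key : 0 ≤ c * (α + 2) * (n - 1) * (r * cosh r / sinh r - 1) * (x ^ 2 / (r ^ α * r ^ 4)) := by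
    have : 0 ≤ α + 2 := by linarith
    have : 0 ≤ n - 1 := by linarith
    positivity
  refine key.trans_eq ?_
  generalize r ^ α = p at *
  rw [hc]
  field_simp
  ring

/-- Key auxiliary inequality for the improved weighted Rellich inequality on `ℍ^N`. -/
theorem rellich_aux (N : ℕ) (α : ℝ) (hα0 : -2 ≤ α) (hα : α < (N : ℝ) - 4)
    (u : ℝ → EuclideanSpace ℝ (Fin N) → ℝ) (hu : IsCcAway N u) :
    hypInt N (fun r σ => r ^ (-α) *
        (radLap N u r σ + (((N : ℝ) + α) * ((N : ℝ) - α - 4) / 4) * u r σ / r ^ 2) ^ 2) ≤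
      hypInt N (fun r σ => (radLap N u r σ) ^ 2 / r ^ α)
      - (((N : ℝ) + α) * ((N : ℝ) - α - 4) / 2) *
          hypInt N (fun r σ => (radGrad N u r σ) ^ 2 / r ^ (α + 2))
      + (((N : ℝ) + α) * ((N : ℝ) - 3 * α - 8) * ((N : ℝ) - α - 4) ^ 2 / 16) *
          hypInt N (fun r σ => (u r σ) ^ 2 / r ^ (α + 4)) := by
  obtain ⟨hC, a₀, b₀, ha₀, hab₀, h0⟩ := hu
  obtain ⟨a, ha, haa⟩ := exists_between ha₀
  obtain ⟨b, hbb⟩ := exists_gt b₀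
  have hab : a ≤ b := by linarith
  have hN4 : (2 : ℝ) < N := by linarith
  have hN : 2 < N := by exact_mod_cast hN4
  set c : ℝ := ((N : ℝ) + α) * ((N : ℝ) - α - 4) / 4 with hc
  have hc0 : 0 ≤ c := div_nonneg (mul_nonneg (by linarith) (by linarith)) (by norm_num)
  have hC₁ := contDiff_radGrad hC
  have hC₂ := contDiff_radGrad hC₁
  have hz : ∀ σ ∈ Metric.sphere (0 : EuclideanSpace ℝ (Fin N)) 1, ∀ r ∉ Icc a b, u r σ = 0 :=
    fun σ hσ r hr => h0 r (fun h => hr ⟨haa.le.trans h.1, h.2.trans hbb.le⟩) σ hσ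
  have hz₁ : ∀ σ ∈ Metric.sphere (0 : EuclideanSpace ℝ (Fin N)) 1, ∀ r ∉ Icc a b,
      radGrad N u r σ = 0 := fun σ hσ => radGrad_eq_zero (hz σ hσ)
  have hz₂ : ∀ σ ∈ Metric.sphere (0 : EuclideanSpace ℝ (Fin N)) 1, ∀ r ∉ Icc a b,
      radGrad N (radGrad N u) r σ = 0 := fun σ hσ => radGrad_eq_zero (hz₁ σ hσ)
  have hL : ∀ r σ, radLap N u r σ = radGrad N (radGrad N u) r σ
      + ((N : ℝ) - 1) * (cosh r / sinh r) * radGrad N u r σ := fun _ _ => rfl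
  have hcoth : ContinuousOn (fun p : ℝ × EuclideanSpace ℝ (Fin N) => cosh p.1 / sinh p.1)
      (Ioi 0 ×ˢ univ) :=
    ContinuousOn.div (by fun_prop) (by fun_prop) fun p hp => (sinh_pos_iff.2 hp.1).ne'
  have hpow : ∀ β : ℝ, ContinuousOn (fun p : ℝ × EuclideanSpace ℝ (Fin N) => p.1 ^ β)
      (Ioi 0 ×ˢ univ) := fun β =>
    continuousOn_fst.rpow_const fun p hp => Or.inl (ne_of_gt hp.1)
  have hpow0 : ∀ β : ℝ, ∀ p ∈ Ioi (0 : ℝ) ×ˢ (univ : Set (EuclideanSpace ℝ (Fin N))), p.1 ^ β ≠ 0 :=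
    fun β p hp => (rpow_pos_of_pos hp.1 β).ne'
  have hcu : ContinuousOn (fun p : ℝ × EuclideanSpace ℝ (Fin N) => u p.1 p.2) (Ioi 0 ×ˢ univ) :=
    hC.continuous.continuousOn
  have hcu₁ : ContinuousOn (fun p : ℝ × EuclideanSpace ℝ (Fin N) => radGrad N u p.1 p.2)
      (Ioi 0 ×ˢ univ) := hC₁.continuous.continuousOn
  have hcL : ContinuousOn (fun p : ℝ × EuclideanSpace ℝ (Fin N) => radLap N u p.1 p.2)
      (Ioi 0 ×ˢ univ) :=
    hC₂.continuous.continuousOn.add ((continuousOn_const.mul hcoth).mul hcu₁)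
  have hzL : ∀ σ ∈ Metric.sphere (0 : EuclideanSpace ℝ (Fin N)) 1, ∀ r ∉ Icc a b,
      radLap N u r σ = 0 := fun σ hσ r hr => by
    rw [hL, hz₁ σ hσ r hr, hz₂ σ hσ r hr, mul_zero, add_zero]
  have hA : IsShell N a b fun r σ => r ^ (-α) * (radLap N u r σ + c * u r σ / r ^ 2) ^ 2 :=
    ⟨(hpow _).mul ((hcL.add ((continuousOn_const.mul hcu).div (by fun_prop)
      fun p hp => pow_ne_zero 2 (ne_of_gt hp.1))).pow 2),
      fun σ hσ r hr => by simp [hz σ hσ r hr, hzL σ hσ r hr]⟩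
  have hB : IsShell N a b fun r σ => radLap N u r σ ^ 2 / r ^ α :=
    ⟨(hcL.pow 2).div (hpow _) (hpow0 _), fun σ hσ r hr => by simp [hzL σ hσ r hr]⟩
  have hD : IsShell N a b fun r σ => radGrad N u r σ ^ 2 / r ^ (α + 2) :=
    ⟨(hcu₁.pow 2).div (hpow _) (hpow0 _), fun σ hσ r hr => by simp [hz₁ σ hσ r hr]⟩
  have hE : IsShell N a b fun r σ => u r σ ^ 2 / r ^ (α + 4) :=
    ⟨(hcu.pow 2).div (hpow _) (hpow0 _), fun σ hσ r hr => by simp [hz σ hσ r hr]⟩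
  set J : ℝ → EuclideanSpace ℝ (Fin N) → ℝ := fun r σ =>
    radLap N u r σ * u r σ * r ^ (-α - 2) + radGrad N u r σ ^ 2 * r ^ (-α - 2)
      + (α + 2) / 2 * u r σ ^ 2 * (((N : ℝ) - 1) * (cosh r / sinh r) * r ^ (-α - 3)
        - (α + 3) * r ^ (-α - 4)) with hJdef
  have hJ : IsShell N a b J :=
    ⟨(((hcL.mul hcu).mul (hpow _)).add ((hcu₁.pow 2).mul (hpow _))).add
      ((continuousOn_const.mul (hcu.pow 2)).mul
        (((continuousOn_const.mul hcoth).mul (hpow _)).sub (continuousOn_const.mul (hpow _)))),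
      fun σ hσ r hr => by simp [hJdef, hz σ hσ r hr, hz₁ σ hσ r hr]⟩
  have hJ0 : ∀ σ ∈ Metric.sphere (0 : EuclideanSpace ℝ (Fin N)) 1,
      ∫ r in Ioi 0, J r σ * sinh r ^ (N - 1) = 0 := by
    intro σ hσ
    rw [hJ.integral_eq ha hab hσ]
    obtain ⟨m, rfl⟩ : ∃ m, N = m + 2 := ⟨N - 2, by omega⟩
    have hderiv : ∀ r ∈ uIcc a b, HasDerivAt
        (fun r => sinh r ^ (m + 1) * (u r σ * radGrad (m + 2) u r σ * r ^ (-α - 2)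
          + (α + 2) / 2 * (u r σ ^ 2 * r ^ (-α - 3)))) (J r σ * sinh r ^ (m + 2 - 1)) r := by
      intro r hr
      rw [uIcc_of_le hab] at hr
      refine (hasDerivAt_flux (α := α) m (ha.trans_le hr.1) (hasDerivAt_radGrad hC r σ)
        (hasDerivAt_radGrad hC₁ r σ)).congr_deriv ?_
      have hm : ((m + 2 : ℕ) : ℝ) - 1 = m + 1 := by
        push_cast
        ring
      simp only [hJdef, hL, hm]
      rfl
    rw [intervalIntegral.integral_eq_sub_of_hasDerivAt hderiv
      ((hJ.continuousOn_mul_sinh ha σ).intervalIntegrable_of_Icc hab),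
      h0 a (fun h => haa.not_ge h.1) σ hσ, h0 b (fun h => hbb.not_ge h.2) σ hσ]
    simp
  have iB := hB.integrableOn_sphere ha hab (by omega)
  have iD := hD.integrableOn_sphere ha hab (by omega)
  have iE := hE.integrableOn_sphere ha hab (by omega)
  unfold hypInt
  rw [← integral_sub_const_mul_add_const_mul iB iD iE]
  refine setIntegral_mono_on (hA.integrableOn_sphere ha hab (by omega))
    (integrable_sub_const_mul_add_const_mul iB iD iE _ _) Metric.isClosed_sphere.measurableSet
    fun σ hσ => ?_
  have jB := hB.integrableOn ha hσ
  have jD := hD.integrableOn ha hσ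
  have jE := hE.integrableOn ha hσ
  have jJ := (hJ.integrableOn ha hσ).const_mul (2 * c)
  have j := integrable_sub_const_mul_add_const_mul jB jD jE
    (((N : ℝ) + α) * ((N : ℝ) - α - 4) / 2)
    (((N : ℝ) + α) * ((N : ℝ) - 3 * α - 8) * ((N : ℝ) - α - 4) ^ 2 / 16)
  rw [← integral_sub_const_mul_add_const_mul jB jD jE]
  have hmono := setIntegral_mono_on (hA.integrableOn ha hσ) (j.add jJ) measurableSet_Ioi
    fun r hr => by
      have hpt := mul_le_mul_of_nonneg_right
        (rellich_pointwise (x := u r σ) (y := radGrad N u r σ) (z := radLap N u r σ) hr hα0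
          (by linarith : (1 : ℝ) ≤ N) hc0 hc) (pow_nonneg (sinh_pos_iff.2 hr).le (N - 1))
      refine hpt.trans_eq ?_
      simp only [hJdef, hc, Pi.add_apply]
      ring
  rwa [integral_add' j jJ, integral_const_mul, hJ0 σ hσ, mul_zero, add_zero] at hmono
end
end

section
/- Let N ≥ 7. Then for every u ∈ C_c^∞(ℍ^N∖{o}) one has ∫_{ℍ^N} (Δ_r u)² dv − ((N−1)/2)⁴ ∫_{ℍ^N} u² dv ≥ ((N−4)²/16) ∫_{ℍ^N} u²/r⁴ dv + ((N²−1)/16) ∫_{ℍ^N} u²/r² dv. -/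
open MeasureTheory Real Set

noncomputable section

theorem hausdorffMeasure_unitSphere_lt_top {E : Type*} [NormedAddCommGroup E]
    [InnerProductSpace ℝ E] [FiniteDimensional ℝ E] [MeasurableSpace E] [BorelSpace E] {n : ℕ}
    (hn : Module.finrank ℝ E = n + 1) :
    μH[(n : ℝ)] (Metric.sphere (0 : E) 1) < ⊤ := by
  refine (isCompact_sphere (0 : E) 1).measure_lt_top_of_nhdsWithin fun x hx => ?_
  have hx1 : ‖x‖ = 1 := by simpa using hx
  have hv : ‖-x‖ = 1 := by rwa [norm_neg]
  have : Fact (Module.finrank ℝ E = n + 1) := ⟨hn⟩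
  have hrank : Module.finrank ℝ (ℝ ∙ (-x))ᗮ = n :=
    Submodule.finrank_orthogonal_span_singleton (by simpa using norm_ne_zero_iff.1 (by simp [hx1]))
  have hsmooth : ContDiff ℝ 1 (fun w : (ℝ ∙ (-x))ᗮ => stereoInvFunAux (-x) (w : E)) :=
    contDiff_stereoInvFunAux.comp (ℝ ∙ (-x))ᗮ.subtypeL.contDiff
  obtain ⟨K, t, ht, hK⟩ :=
    (hsmooth.contDiffAt (x := stereoToFun (-x) x)).exists_lipschitzOnWith
  let μ : Measure (ℝ ∙ (-x))ᗮ := μH[(Module.finrank ℝ (ℝ ∙ (-x))ᗮ : ℝ)]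
  obtain ⟨s, hs, hs'⟩ := μ.finiteAt_nhds (stereoToFun (-x) x)
  refine ⟨(fun w : (ℝ ∙ (-x))ᗮ => stereoInvFunAux (-x) (w : E)) '' (t ∩ s), ?_, ?_⟩
  · have hne : innerSL ℝ (-x) x ≠ (1 : ℝ) := by
      simp [hx1]
      norm_num
    have hopen : IsOpen {y : E | innerSL ℝ (-x) y ≠ (1 : ℝ)} :=
      isOpen_ne_fun (innerSL ℝ (-x)).continuous continuous_const
    have hcont : ContinuousAt (stereoToFun (-x)) x :=
      continuousOn_stereoToFun.continuousAt (hopen.mem_nhds hne)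
    filter_upwards [mem_nhdsWithin_of_mem_nhds (hcont.preimage_mem_nhds (Filter.inter_mem ht hs)),
      mem_nhdsWithin_of_mem_nhds (hopen.mem_nhds hne), self_mem_nhdsWithin] with y hy hy' hyS
    refine ⟨stereoToFun (-x) y, hy, ?_⟩
    have hyv : ((⟨y, hyS⟩ : Metric.sphere (0 : E) 1) : E) ≠ -x := by
      rintro rfl
      simp [hx1] at hy'
    simpa using congrArg Subtype.val (stereo_left_inv hv hyv)
  · refine ((hK.mono inter_subset_left).hausdorffMeasure_image_le n.cast_nonneg).trans_lt ?_
    refine ENNReal.mul_lt_top (by simp) ((measure_mono inter_subset_right).trans_lt ?_)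
    simpa [μ, hrank] using hs'

theorem sinh_le_two_mul_of_le_one {r : ℝ} (h0 : 0 ≤ r) (h1 : r ≤ 1) : sinh r ≤ 2 * r := by
  have hp := abs_le.1 (abs_exp_sub_one_le (x := r) (by rwa [abs_of_nonneg h0]))
  have hm := abs_le.1 (abs_exp_sub_one_le (x := -r) (by rwa [abs_neg, abs_of_nonneg h0]))
  rw [abs_neg] at hm
  rw [abs_of_nonneg h0] at hp hm
  rw [sinh_eq]
  linarith [hp.2, hm.1]

theorem rellich_potential_nonneg {n R S : ℝ} (hn : 7 ≤ n) (hR : 0 < R) (hS : 0 < S)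
    (hRS : 1 ≤ R → R ≤ 2 * S) :
    0 ≤ (n - 1) * (n - 3) / 16 * R ^ 2
      + (2 * ((n - 1) / 2) ^ 2 - 4) * ((n - 1) * (n - 3) / 4) * S ^ 2
      + (n - 1) * (n - 3) / 4 * ((n - 7) * (n + 3) / 4) * S ^ 4
      - (n - 1) * (n - 7) / 16 * R ^ 4 := by
  have h1 : 0 ≤ n - 1 := by linarith
  have h3 : 0 ≤ n - 3 := by linarith
  have h7 : 0 ≤ n - 7 := by linarith
  have hmid : 0 ≤ (2 * ((n - 1) / 2) ^ 2 - 4) * ((n - 1) * (n - 3) / 4) * S ^ 2 := by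
    have : 0 ≤ 2 * ((n - 1) / 2) ^ 2 - 4 := by nlinarith
    positivity
  rcases le_total R 1 with h | h
  · have hR42 : R ^ 4 ≤ R ^ 2 := pow_le_pow_of_le_one hR.le h (by norm_num)
    have hA : (n - 1) * (n - 7) / 16 * R ^ 4 ≤ (n - 1) * (n - 3) / 16 * R ^ 2 := by
      gcongr
      norm_num
    have : 0 ≤ (n - 1) * (n - 3) / 4 * ((n - 7) * (n + 3) / 4) * S ^ 4 := by positivity
    linarith
  · have hR4 : R ^ 4 ≤ 16 * S ^ 4 := by
      calc R ^ 4 ≤ (2 * S) ^ 4 := by gcongr; exact hRS h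
        _ = 16 * S ^ 4 := by ring
    have hc : 0 ≤ (n - 1) * (n - 7) / 16 := by positivity
    have hA : (n - 1) * (n - 7) / 16 * R ^ 4 ≤ (n - 1) * (n - 7) / 16 * (16 * S ^ 4) := by gcongr
    have hB : 0 ≤ (n - 1) * (n - 7) / 16 * S ^ 4 * ((n - 3) * (n + 3) - 16) := by
      have : 0 ≤ (n - 3) * (n + 3) - 16 := by nlinarith
      positivity
    have hC : 0 ≤ (n - 1) * (n - 3) / 16 * R ^ 2 := by positivity
    linarith

theorem rellich_pointwise_s16 {n R S k f p q : ℝ} (hn : 7 ≤ n) (hR : 0 < R) (hS : 0 < S)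
    (hk : k ^ 2 = 1 + S ^ 2) (hRS : 1 ≤ R → R ≤ 2 * S) :
    (q * f + p * p) * (-2 * ((n - 1) / 2) ^ 2 - 2 * ((n - 1) * (n - 3) / 4) * S ^ 2)
        + p * f * (4 * ((n - 1) * (n - 3) / 4) * (k * S ^ 2))
      + ((q * p + p * q) * (R / 2) + p * p * (-R ^ 2 / 2))
      + ((p * f + f * p) * (-2 * ((n - 1) * (n - 3) / 4) * (k * S ^ 2) + 3 / 8 * R ^ 3
            + ((n - 1) / 2) ^ 2 * R)
          + f * f * (-2 * ((n - 1) * (n - 3) / 4) * (-S ^ 4 - 2 * k ^ 2 * S ^ 2) - 9 / 8 * R ^ 4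
            - ((n - 1) / 2) ^ 2 * R ^ 2)) ≤
      (q - (((n - 1) / 2) ^ 2 + (n - 1) * (n - 3) / 4 * S ^ 2) * f) ^ 2
        - ((n - 1) / 2) ^ 4 * f ^ 2 - (n - 4) ^ 2 / 16 * (f ^ 2 * R ^ 4)
        - (n ^ 2 - 1) / 16 * (f ^ 2 * R ^ 2) := by
  have hpot := mul_nonneg (rellich_potential_nonneg hn hR hS hRS) (sq_nonneg f)
  have hsq1 := sq_nonneg (q - p * R / 2)
  have hsq2 := mul_nonneg (sq_nonneg (R / 2)) (sq_nonneg (p - 3 / 2 * f * R))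
  have hsq3 := mul_nonneg (sq_nonneg ((n - 1) / 2)) (sq_nonneg (p - f * R / 2))
  have hsq4 : 0 ≤ (n - 1) * (n - 3) / 4 * (S ^ 2 * p ^ 2) := by
    have h1 : 0 ≤ n - 1 := by linarith
    have h3 : 0 ≤ n - 3 := by linarith
    positivity
  rw [hk]
  linear_combination hpot + hsq1 + hsq2 + 2 * hsq3 + 2 * hsq4

theorem hasDerivAt_weighted_mul {w A B φ : ℝ → ℝ} {m k a b φ' r : ℝ}
    (hw : HasDerivAt w (2 * m * k * w r) r) (hA : HasDerivAt A (a - m * k * A r) r)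
    (hB : HasDerivAt B (b - m * k * B r) r) (hφ : HasDerivAt φ φ' r) :
    HasDerivAt (fun t => w t * (A t * B t * φ t))
      (w r * ((a * B r + A r * b) * φ r + A r * B r * φ')) r := by
  refine (hw.fun_mul ((hA.fun_mul hB).fun_mul hφ)).congr_deriv ?_
  ring

theorem integral_Ioi_nonneg_of_hasDerivAt_le {H G G' : ℝ → ℝ} {a b : ℝ} (ha : 0 < a) (hab : a ≤ b)
    (hHc : ContinuousOn H (Ioi 0)) (hH : ∀ r, r ∉ Icc a b → H r = 0)
    (hG : ∀ r, r ∉ Icc a b → G r = 0) (hd : ∀ r, 0 < r → HasDerivAt G (G' r) r)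
    (hle : ∀ r, 0 < r → G' r ≤ H r) : 0 ≤ ∫ r in Ioi (0 : ℝ), H r := by
  have hsub : Icc (a / 2) (b + 1) ⊆ Ioi (0 : ℝ) := fun r hr => (half_pos ha).trans_le hr.1
  have h := intervalIntegral.sub_le_integral_of_hasDeriv_right_of_le (a := a / 2) (b := b + 1)
    (by linarith) (fun r hr => (hd r (hsub hr)).continuousAt.continuousWithinAt)
    (fun r hr => (hd r (hsub (Ioo_subset_Icc_self hr))).hasDerivWithinAt)
    (hHc.mono hsub).integrableOn_Icc (fun r hr => hle r (hsub (Ioo_subset_Icc_self hr)))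
  rw [hG _ fun h => by linarith [h.2], hG _ fun h => by linarith [h.1], sub_zero,
    intervalIntegral.integral_of_le (by linarith), ← integral_Icc_eq_integral_Ioc] at h
  rwa [setIntegral_eq_of_subset_of_forall_sdiff_eq_zero measurableSet_Ioi hsub]
  exact fun r hr => hH r fun hr' => hr.2 ⟨by linarith [hr'.1], by linarith [hr'.2]⟩

theorem rellich_radial (N : ℕ) (hN : 7 ≤ N) {f f₁ f₂ : ℝ → ℝ} {a b : ℝ} (ha : 0 < a) (hab : a ≤ b)
    (hf : ∀ r, HasDerivAt f (f₁ r) r) (hf₁ : ∀ r, HasDerivAt f₁ (f₂ r) r) (hf₂ : Continuous f₂)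
    (h0 : ∀ r, r ∉ Icc a b → f r = 0) (h1 : ∀ r, r ∉ Icc a b → f₁ r = 0)
    (h2 : ∀ r, r ∉ Icc a b → f₂ r = 0) :
    0 ≤ ∫ r in Ioi (0 : ℝ),
      ((f₂ r + ((N : ℝ) - 1) * (cosh r / sinh r) * f₁ r) ^ 2 * sinh r ^ (N - 1)
        - (((N : ℝ) - 1) / 2) ^ 4 * (f r ^ 2 * sinh r ^ (N - 1))
        - ((N : ℝ) - 4) ^ 2 / 16 * (f r ^ 2 / r ^ 4 * sinh r ^ (N - 1))
        - ((N : ℝ) ^ 2 - 1) / 16 * (f r ^ 2 / r ^ 2 * sinh r ^ (N - 1))) := by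
  set n : ℝ := (N : ℝ) with hn_def
  have hn : 7 ≤ n := by rw [hn_def]; exact_mod_cast hN
  have hsinh : ∀ r : ℝ, 0 < r → 0 < sinh r := fun r hr => sinh_pos_iff.2 hr
  let m : ℝ := (n - 1) / 2
  let c : ℝ := (n - 1) * (n - 3) / 4
  let w : ℝ → ℝ := fun r => sinh r ^ (N - 1)
  let p : ℝ → ℝ := fun r => f₁ r + m * (cosh r / sinh r) * f r
  let q : ℝ → ℝ := fun r => f₂ r + 2 * m * (cosh r / sinh r) * f₁ r
    + (m ^ 2 * (cosh r / sinh r) ^ 2 - m * (1 / sinh r) ^ 2) * f r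
  have hw : ∀ r, 0 < r → HasDerivAt w (2 * m * (cosh r / sinh r) * w r) r := by
    intro r hr
    have hs := (hsinh r hr).ne'
    obtain ⟨j, rfl⟩ : ∃ j, N = j + 2 := ⟨N - 2, by omega⟩
    refine ((hasDerivAt_sinh r).fun_pow (j + 2 - 1)).congr_deriv ?_
    simp only [w, m, hn_def, Nat.add_sub_cancel, show j + 2 - 1 = j + 1 by omega]
    push_cast
    field_simp
    ring
  have hcoth : ∀ r, 0 < r → HasDerivAt (fun t => cosh t / sinh t) (-(1 / sinh r) ^ 2) r := by
    intro r hr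
    have hs := (hsinh r hr).ne'
    refine ((hasDerivAt_cosh r).fun_div (hasDerivAt_sinh r) hs).congr_deriv ?_
    field_simp
    linarith [cosh_sq r]
  have hcsch : ∀ r, 0 < r →
      HasDerivAt (fun t => (1 / sinh t) ^ 2) (-2 * (cosh r / sinh r * (1 / sinh r) ^ 2)) r := by
    intro r hr
    have hs := (hsinh r hr).ne'
    refine ((((hasDerivAt_const r (1 : ℝ)).fun_div (hasDerivAt_sinh r) hs).fun_pow 2)).congr_deriv ?_
    norm_num
    field_simp
  have hinv : ∀ r : ℝ, 0 < r → HasDerivAt (fun t : ℝ => 1 / t) (-(1 / r) ^ 2) r := by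
    intro r hr
    refine ((hasDerivAt_const r (1 : ℝ)).fun_div (hasDerivAt_id r) hr.ne').congr_deriv ?_
    simp
    field_simp
  have hfp : ∀ r, HasDerivAt f (p r - m * (cosh r / sinh r) * f r) r := by
    intro r
    refine (hf r).congr_deriv ?_
    simp only [p]
    ring
  have hpq : ∀ r, 0 < r → HasDerivAt p (q r - m * (cosh r / sinh r) * p r) r := by
    intro r hr
    refine ((hf₁ r).fun_add (((hcoth r hr).const_mul m).fun_mul (hf r))).congr_deriv ?_
    simp only [p, q]
    ring
  have hcoth_sq : ∀ r, 0 < r → (cosh r / sinh r) ^ 2 = 1 + (1 / sinh r) ^ 2 := by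
    intro r hr
    have hs := (hsinh r hr).ne'
    field_simp
    linarith [cosh_sq r]
  have hRS : ∀ r : ℝ, 0 < r → 1 ≤ 1 / r → 1 / r ≤ 2 * (1 / sinh r) := by
    intro r hr hr1
    have hs := hsinh r hr
    have := sinh_le_two_mul_of_le_one hr.le ((one_le_div hr).1 hr1)
    rw [mul_one_div, div_le_div_iff₀ hr hs]
    linarith
  let G : ℝ → ℝ := fun t =>
    w t * (p t * f t * (-2 * m ^ 2 - 2 * c * (1 / sinh t) ^ 2))
      + w t * (p t * p t * (1 / t / 2))
      + w t * (f t * f t * (-2 * c * (cosh t / sinh t * (1 / sinh t) ^ 2) + 3 / 8 * (1 / t) ^ 3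
          + m ^ 2 * (1 / t)))
  have hG : ∀ r, 0 < r → HasDerivAt G _ r := fun r hr =>
    ((hasDerivAt_weighted_mul (hw r hr) (hpq r hr) (hfp r)
      ((hasDerivAt_const r (-2 * m ^ 2)).fun_sub ((hcsch r hr).const_mul (2 * c)))).fun_add
    (hasDerivAt_weighted_mul (hw r hr) (hpq r hr) (hpq r hr) ((hinv r hr).div_const 2))).fun_add
    (hasDerivAt_weighted_mul (hw r hr) (hfp r) (hfp r)
      (((((hcoth r hr).fun_mul (hcsch r hr)).const_mul (-2 * c)).fun_add
        (((hinv r hr).fun_pow 3).const_mul (3 / 8))).fun_add ((hinv r hr).const_mul (m ^ 2))))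
  refine integral_Ioi_nonneg_of_hasDerivAt_le (G := G) ha hab ?_ ?_ ?_ hG ?_
  · have hfc : Continuous f := continuous_iff_continuousAt.2 fun r => (hf r).continuousAt
    have hf₁c : Continuous f₁ := continuous_iff_continuousAt.2 fun r => (hf₁ r).continuousAt
    have hne : ∀ r ∈ Ioi (0 : ℝ), r ≠ 0 := fun r hr => (mem_Ioi.1 hr).ne'
    have hsne : ∀ r ∈ Ioi (0 : ℝ), sinh r ≠ 0 := fun r hr => (hsinh r hr).ne'
    have hne4 : ∀ r ∈ Ioi (0 : ℝ), r ^ 4 ≠ 0 := fun r hr => pow_ne_zero _ (hne r hr)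
    have hne2 : ∀ r ∈ Ioi (0 : ℝ), r ^ 2 ≠ 0 := fun r hr => pow_ne_zero _ (hne r hr)
    fun_prop (disch := assumption)
  · intro r hr
    simp [h0 r hr, h1 r hr, h2 r hr]
  · intro r hr
    simp [G, p, h0 r hr, h1 r hr]
  · intro r hr
    have hwpos : 0 < w r := pow_pos (hsinh r hr) _
    have hlap : f₂ r + (n - 1) * (cosh r / sinh r) * f₁ r
        = q r - (m ^ 2 + c * (1 / sinh r) ^ 2) * f r := by
      simp only [q, hcoth_sq r hr, m, c]
      ring
    have key := mul_le_mul_of_nonneg_left (rellich_pointwise_s16 (f := f r) (p := p r) (q := q r) hn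
      (one_div_pos.2 hr) (one_div_pos.2 (hsinh r hr)) (hcoth_sq r hr) (hRS r hr)) hwpos.le
    rw [hlap]
    have hk := hcoth_sq r hr
    have hr4 : f r ^ 2 / r ^ 4 = f r ^ 2 * (1 / r) ^ 4 := by rw [one_div, inv_pow]; rfl
    have hr2 : f r ^ 2 / r ^ 2 = f r ^ 2 * (1 / r) ^ 2 := by rw [one_div, inv_pow]; rfl
    rw [hr4, hr2]
    simp only [m, c, w] at key ⊢
    generalize cosh r / sinh r = k at *
    generalize 1 / sinh r = S at *
    generalize 1 / r = R at *
    generalize sinh r ^ (N - 1) = W at *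
    linear_combination key

theorem integrable_of_radial_support {X : Type*} [TopologicalSpace X] [MeasurableSpace X]
    [OpensMeasurableSpace X] [T2Space X] [SecondCountableTopology X] {μ : Measure X} {s : Set X}
    (hs : IsCompact s) (hμ : μ s < ⊤) {K : ℝ → X → ℝ} {a b : ℝ} (ha : 0 < a) (hab : a ≤ b)
    (hK : ContinuousOn (Function.uncurry K) (Ioi 0 ×ˢ univ))
    (h0 : ∀ r, r ∉ Icc a b → ∀ σ ∈ s, K r σ = 0) :
    (∀ σ ∈ s, IntegrableOn (fun r => K r σ) (Ioi 0)) ∧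
      IntegrableOn (fun σ => ∫ r in Ioi (0 : ℝ), K r σ) s μ := by
  have hsub : Icc a b ⊆ Ioi (0 : ℝ) := fun r hr => ha.trans_le hr.1
  constructor
  · intro σ hσ
    have hc : ContinuousOn (fun r => K r σ) (Icc a b) :=
      hK.comp (f := fun r : ℝ => (r, σ)) (by fun_prop) fun r hr => ⟨hsub hr, mem_univ σ⟩
    exact hc.integrableOn_Icc.of_forall_sdiff_eq_zero measurableSet_Ioi
      fun r hr => h0 r hr.2 σ hσ
  · have hcont : Continuous (Function.uncurry fun (σ : X) (r : ℝ) => K (max r a) σ) :=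
      hK.comp_continuous (f := fun x : X × ℝ => (max x.2 a, x.1)) (by fun_prop)
        fun x => ⟨ha.trans_le (le_max_right _ _), mem_univ _⟩
    have hint : Continuous fun σ => ∫ r in a..b, K (max r a) σ :=
      intervalIntegral.continuous_parametric_intervalIntegral_of_continuous' hcont a b
    refine (hint.continuousOn.integrableOn_of_subset_isCompact hs hs.measurableSet subset_rfl
      hμ.ne).congr_fun (fun σ hσ => ?_) hs.measurableSet
    dsimp only
    rw [setIntegral_eq_of_subset_of_forall_sdiff_eq_zero measurableSet_Ioi hsub
        fun r hr => h0 r hr.2 σ hσ,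
      intervalIntegral.integral_of_le hab, ← integral_Icc_eq_integral_Ioc]
    exact setIntegral_congr_fun measurableSet_Icc fun r hr => by simp [max_eq_left hr.1]

theorem contDiff_deriv_fst {E : Type*} [NormedAddCommGroup E] [NormedSpace ℝ E] {u : ℝ → E → ℝ}
    (hu : ContDiff ℝ (⊤ : ℕ∞) (Function.uncurry u)) :
    ContDiff ℝ (⊤ : ℕ∞) (Function.uncurry fun r σ => deriv (fun s => u s σ) r) ∧
      ∀ r σ, HasDerivAt (fun s => u s σ) (deriv (fun s => u s σ) r) r := by
  have hd : ∀ r σ, HasDerivAt (fun s => u s σ) (fderiv ℝ (Function.uncurry u) (r, σ) (1, 0)) r :=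
    fun r σ => ((hu.differentiable (by simp)) (r, σ)).hasFDerivAt.comp_hasDerivAt
      (f := fun s => (s, σ)) r ((hasDerivAt_id r).prodMk (hasDerivAt_const r σ))
  refine ⟨?_, fun r σ => (hd r σ).differentiableAt.hasDerivAt⟩
  have h : ContDiff ℝ (⊤ : ℕ∞) fun x => fderiv ℝ (Function.uncurry u) x (1, 0) :=
    (hu.fderiv_right (by simp)).clm_apply contDiff_const
  convert h using 1
  ext ⟨r, σ⟩
  exact (hd r σ).deriv

theorem deriv_eq_zero_of_eq_zero_off_Icc {f : ℝ → ℝ} {a b : ℝ} (h0 : ∀ r, r ∉ Icc a b → f r = 0)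
    {r : ℝ} (hr : r ∉ Icc a b) : deriv f r = 0 := by
  have h : f =ᶠ[nhds r] fun _ => 0 := by
    filter_upwards [isClosed_Icc.isOpen_compl.mem_nhds hr] with t ht using h0 t ht
  rw [h.deriv_eq, deriv_const]

theorem integral_sub_const_mul₃ {α : Type*} [MeasurableSpace α] {μ : Measure α} {A B C D : α → ℝ}
    (hA : Integrable A μ) (hB : Integrable B μ) (hC : Integrable C μ) (hD : Integrable D μ)
    {β γ δ : ℝ} :
    (∫ x, A x ∂μ) - β * (∫ x, B x ∂μ) - γ * (∫ x, C x ∂μ) - δ * (∫ x, D x ∂μ)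
      = ∫ x, (A x - β * B x - γ * C x - δ * D x) ∂μ := by
  have hAB : Integrable (fun x => A x - β * B x) μ := hA.sub (hB.const_mul β)
  have hABC : Integrable (fun x => A x - β * B x - γ * C x) μ := hAB.sub (hC.const_mul γ)
  rw [integral_sub hABC (hD.const_mul δ), integral_sub hAB (hC.const_mul γ),
    integral_sub hA (hB.const_mul β), integral_const_mul, integral_const_mul, integral_const_mul]

/-- Improved radial Rellich inequality with Poincaré term on `ℍ^N`, `N ≥ 7`. -/
theorem rellich_poincare_improved' (N : ℕ) (hN : 7 ≤ N)
    (u : ℝ → EuclideanSpace ℝ (Fin N) → ℝ) (hu : IsCcAway N u) :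
    hypInt N (fun r σ => (radLap N u r σ) ^ 2)
      - (((N : ℝ) - 1) / 2) ^ 4 * hypInt N (fun r σ => (u r σ) ^ 2) ≥
      (((N : ℝ) - 4) ^ 2 / 16) * hypInt N (fun r σ => (u r σ) ^ 2 / r ^ 4)
      + (((N : ℝ) ^ 2 - 1) / 16) * hypInt N (fun r σ => (u r σ) ^ 2 / r ^ 2) := by
  obtain ⟨hsm, a, b, ha, hab, h0⟩ := hu
  obtain ⟨hsm₁, hd⟩ := contDiff_deriv_fst hsm
  obtain ⟨hsm₂, hd₁⟩ := contDiff_deriv_fst hsm₁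
  have h1 : ∀ r, r ∉ Icc a b → ∀ σ ∈ Metric.sphere (0 : EuclideanSpace ℝ (Fin N)) 1,
      deriv (fun s => u s σ) r = 0 := fun r hr σ hσ =>
    deriv_eq_zero_of_eq_zero_off_Icc (fun t ht => h0 t ht σ hσ) hr
  have h2 : ∀ r, r ∉ Icc a b → ∀ σ ∈ Metric.sphere (0 : EuclideanSpace ℝ (Fin N)) 1,
      deriv (fun s => deriv (fun t => u t σ) s) r = 0 := fun r hr σ hσ =>
    deriv_eq_zero_of_eq_zero_off_Icc (fun t ht => h1 t ht σ hσ) hr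
  have hμ : μH[(N : ℝ) - 1] (Metric.sphere (0 : EuclideanSpace ℝ (Fin N)) 1) < ⊤ := by
    have h := hausdorffMeasure_unitSphere_lt_top (E := EuclideanSpace ℝ (Fin N)) (n := N - 1)
      (by rw [finrank_euclideanSpace_fin]; omega)
    rwa [Nat.cast_sub (by omega), Nat.cast_one] at h
  have hint : ∀ F : ℝ → EuclideanSpace ℝ (Fin N) → ℝ,
      ContinuousOn (fun x : ℝ × EuclideanSpace ℝ (Fin N) => F x.1 x.2) (Ioi 0 ×ˢ univ) →
      (∀ r, r ∉ Icc a b → ∀ σ ∈ Metric.sphere (0 : EuclideanSpace ℝ (Fin N)) 1, F r σ = 0) →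
      _ := fun F hF hF0 =>
    integrable_of_radial_support (K := fun r σ => F r σ * sinh r ^ (N - 1))
      (isCompact_sphere 0 1) hμ ha hab
      (hF.mul (continuous_sinh.comp continuous_fst |>.pow (N - 1)).continuousOn)
      fun r hr σ hσ => by simp [hF0 r hr σ hσ]
  have hc := hsm.continuous.continuousOn (s := Ioi (0 : ℝ) ×ˢ univ)
  have hc₁ := hsm₁.continuous.continuousOn (s := Ioi (0 : ℝ) ×ˢ univ)
  have hc₂ := hsm₂.continuous.continuousOn (s := Ioi (0 : ℝ) ×ˢ univ)
  simp only [Function.uncurry_def] at hc hc₁ hc₂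
  have hne : ∀ k : ℕ, ∀ x ∈ Ioi (0 : ℝ) ×ˢ (univ : Set (EuclideanSpace ℝ (Fin N))),
      x.1 ^ k ≠ 0 := fun k x hx => pow_ne_zero _ (mem_Ioi.1 hx.1).ne'
  have hsne : ∀ x ∈ Ioi (0 : ℝ) ×ˢ (univ : Set (EuclideanSpace ℝ (Fin N))),
      sinh x.1 ≠ 0 := fun x hx => (sinh_pos_iff.2 hx.1).ne'
  have hcoth : ContinuousOn (fun x : ℝ × EuclideanSpace ℝ (Fin N) => cosh x.1 / sinh x.1)
      (Ioi 0 ×ˢ univ) :=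
    (continuous_cosh.comp continuous_fst).continuousOn.div
      (continuous_sinh.comp continuous_fst).continuousOn hsne
  obtain ⟨iL, jL⟩ := hint (fun r σ => radLap N u r σ ^ 2)
    ((hc₂.add ((continuousOn_const.mul hcoth).mul hc₁)).pow 2)
    fun r hr σ hσ => by simp [radLap, h1 r hr σ hσ, h2 r hr σ hσ]
  obtain ⟨i0, j0⟩ := hint (fun r σ => u r σ ^ 2) (hc.pow 2)
    fun r hr σ hσ => by simp [h0 r hr σ hσ]
  obtain ⟨i4, j4⟩ := hint (fun r σ => u r σ ^ 2 / r ^ 4)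
    ((hc.pow 2).div (continuous_fst.pow 4).continuousOn (hne 4))
    fun r hr σ hσ => by simp [h0 r hr σ hσ]
  obtain ⟨i2, j2⟩ := hint (fun r σ => u r σ ^ 2 / r ^ 2)
    ((hc.pow 2).div (continuous_fst.pow 2).continuousOn (hne 2))
    fun r hr σ hσ => by simp [h0 r hr σ hσ]
  rw [ge_iff_le, ← sub_nonneg, ← sub_sub]
  unfold hypInt
  rw [integral_sub_const_mul₃ jL j0 j4 j2]
  refine setIntegral_nonneg Metric.isClosed_sphere.measurableSet fun σ hσ => ?_
  dsimp only
  rw [integral_sub_const_mul₃ (iL σ hσ) (i0 σ hσ) (i4 σ hσ) (i2 σ hσ)]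
  exact rellich_radial N hN ha hab (fun r => hd r σ) (fun r => hd₁ r σ)
    (hsm₂.continuous.comp (Continuous.prodMk_left σ)) (fun r hr => h0 r hr σ hσ)
    (fun r hr => h1 r hr σ hσ) (fun r hr => h2 r hr σ hσ)
end
end
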